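/- A group G of permutations of ℕ is a closed subgroup of S∞ (with the pointwise convergence topology) if and only if G is the automorphism group of a relational Fraïssé structure with universe ℕ. -/

import Mathlib

open FirstOrder CategoryTheory

/-- The topology of pointwise convergence on `S∞`, the permutation group of `ℕ`. -/
noncomputable def pointwiseTopology : TopologicalSpace (Equiv.Perm ℕ) :=
  TopologicalSpace.induced (fun g : Equiv.Perm ℕ => (g : ℕ → ℕ)) inferInstance

/-- A structure is locally finite if it is the union of an increasing chain of finite
substructures. -/
def IsLocallyFinite (L : FirstOrder.Language.{0, 0}) (M : Type) [L.Structure M] : Prop :=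
  ∃ A : ℕ → L.Substructure M, Monotone A ∧ (∀ n, ((A n : Set M)).Finite) ∧
    (⋃ n, ((A n : Set M))) = Set.univ

/-- `M` is ultrahomogeneous: every isomorphism between finite substructures of `M`
extends to an automorphism of `M`. -/
def IsUltrahomog (L : FirstOrder.Language.{0, 0}) (M : Type) [L.Structure M] : Prop :=
  ∀ S T : L.Substructure M, (S : Set M).Finite → (T : Set M).Finite →
    ∀ f : S ≃[L] T, ∃ g : M ≃[L] M, ∀ x : S, g x = f x

theorem continuous_coe_pointwiseTopology :
    @Continuous _ _ pointwiseTopology _ (fun g : Equiv.Perm ℕ => (g : ℕ → ℕ)) :=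
  continuous_induced_dom

/-- A permutation that agrees with members of a closed set on every initial segment belongs to
the set. -/
theorem mem_of_isClosed_of_forall_exists_eqOn {C : Set (Equiv.Perm ℕ)}
    (hC : @IsClosed (Equiv.Perm ℕ) pointwiseTopology C) (f : Equiv.Perm ℕ)
    (h : ∀ n : ℕ, ∃ g ∈ C, ∀ i < n, g i = f i) : f ∈ C := by
  let _ := pointwiseTopology
  choose u hu hfu using h
  have hlim : Filter.Tendsto u Filter.atTop (nhds f) := by
    have hind : Topology.IsInducing fun g : Equiv.Perm ℕ => (g : ℕ → ℕ) := ⟨rfl⟩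
    rw [hind.tendsto_nhds_iff, tendsto_pi_nhds]
    intro i
    refine tendsto_const_nhds.congr' ?_
    filter_upwards [Filter.eventually_gt_atTop i] with n hn
    exact (hfu n i hn).symm
  exact hC.mem_of_tendsto hlim (Filter.Eventually.of_forall hu)

/-- The permutations preserving a given relational structure on `ℕ` form a closed set. -/
theorem isClosed_setOf_preserves (L : FirstOrder.Language.{0, 0}) [L.Structure ℕ] :
    @IsClosed (Equiv.Perm ℕ) pointwiseTopology
      {g | ∀ (n : ℕ) (r : L.Relations n) (x : Fin n → ℕ),
        FirstOrder.Language.Structure.RelMap r (g ∘ x) ↔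
          FirstOrder.Language.Structure.RelMap r x} := by
  let _ := pointwiseTopology
  simp only [Set.ofPred_forall]
  refine isClosed_iInter fun n => isClosed_iInter fun r => isClosed_iInter fun x => ?_
  have hcont : Continuous fun g : Equiv.Perm ℕ => (g ∘ x : Fin n → ℕ) :=
    continuous_pi fun i => (continuous_apply (x i)).comp continuous_coe_pointwiseTopology
  exact (isClosed_discrete {y : Fin n → ℕ | FirstOrder.Language.Structure.RelMap r y ↔
    FirstOrder.Language.Structure.RelMap r x}).preimage hcont

/-- The relational language with one relation symbol for each finite tuple from `ℕ`. -/
def tupleLanguage : FirstOrder.Language.{0, 0} where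
  Functions _ := Empty
  Relations n := Fin n → ℕ

instance tupleLanguage_isRelational : tupleLanguage.IsRelational :=
  fun _ => inferInstanceAs (IsEmpty Empty)

/-- The structure on `ℕ` interpreting the symbol of a tuple as the `G`-orbit of that tuple. -/
abbrev orbitStructure (G : Subgroup (Equiv.Perm ℕ)) : tupleLanguage.Structure ℕ where
  funMap f := f.elim
  RelMap {n} (a : Fin n → ℕ) x := ∃ g ∈ G, ∀ i, g (a i) = x i

/-- Each member of `G` as an automorphism of the orbit structure of `G`. -/
def orbitStructureEquiv (G : Subgroup (Equiv.Perm ℕ)) (h : Equiv.Perm ℕ) (hh : h ∈ G) :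
    letI := orbitStructure G
    ℕ ≃[tupleLanguage] ℕ :=
  letI := orbitStructure G
  { toEquiv := h
    map_fun' := fun f => f.elim
    map_rel' := fun {n} r x => by
      constructor
      · rintro ⟨g, hg, hgx⟩
        refine ⟨h⁻¹ * g, G.mul_mem (G.inv_mem hh) hg, fun i => ?_⟩
        rw [Equiv.Perm.mul_apply, hgx i]
        exact h.symm_apply_apply (x i)
      · rintro ⟨g, hg, hgx⟩
        exact ⟨h * g, G.mul_mem hh hg, fun i => congrArg h (hgx i)⟩ }

theorem isLocallyFinite_of_isRelational (L : FirstOrder.Language.{0, 0}) [L.IsRelational]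
    [L.Structure ℕ] : IsLocallyFinite L ℕ := by
  refine ⟨fun n => ⟨Set.Iio n, fun f => isEmptyElim f⟩, ?_, fun n => Set.finite_Iio n, ?_⟩
  · intro m n hmn x hx
    exact lt_of_lt_of_le hx hmn
  · exact Set.eq_univ_of_forall fun x => Set.mem_iUnion.2 ⟨x + 1, Nat.lt_succ_self x⟩

theorem isUltrahomog_orbitStructure (G : Subgroup (Equiv.Perm ℕ)) :
    @IsUltrahomog tupleLanguage ℕ (orbitStructure G) := by
  let _ := orbitStructure G
  intro S T hS _ f
  have : Finite S := hS
  obtain ⟨n, ⟨e⟩⟩ := Finite.exists_equiv_fin S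
  let a : Fin n → ℕ := fun i => e.symm i
  have ha : FirstOrder.Language.Structure.RelMap (L := tupleLanguage) (M := S) a e.symm :=
    ⟨1, G.one_mem, fun _ => rfl⟩
  obtain ⟨g, hg, hga⟩ := (f.map_rel (n := n) a e.symm).2 ha
  refine ⟨orbitStructureEquiv G g hg, fun x => ?_⟩
  have hx := hga (e x)
  simp only [a, Function.comp_apply, Equiv.symm_apply_apply] at hx
  exact hx

/-- A group of permutations of `ℕ` is a closed subgroup of `S∞` (with the pointwise
convergence topology) iff it is the automorphism group of a relational Fraïssé
structure with universe `ℕ`. -/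
theorem closed_subgroup_iff_automorphism_group_of_fraisse
    (G : Subgroup (Equiv.Perm ℕ)) :
    @IsClosed (Equiv.Perm ℕ) pointwiseTopology (G : Set (Equiv.Perm ℕ)) ↔
      ∃ (L : FirstOrder.Language.{0, 0}) (S : L.Structure ℕ),
        L.IsRelational ∧
        @IsLocallyFinite L ℕ S ∧
        @IsUltrahomog L ℕ S ∧
        ∀ g : Equiv.Perm ℕ,
          g ∈ G ↔ ∃ a : @FirstOrder.Language.Equiv L ℕ ℕ S S, a.toEquiv = g := by
  constructor
  · intro hG
    let _ := orbitStructure G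
    refine ⟨tupleLanguage, orbitStructure G, inferInstance, isLocallyFinite_of_isRelational _,
      isUltrahomog_orbitStructure G, fun g => ⟨fun hg => ⟨orbitStructureEquiv G g hg, rfl⟩, ?_⟩⟩
    rintro ⟨a, rfl⟩
    refine mem_of_isClosed_of_forall_exists_eqOn hG _ fun n => ?_
    let t : Fin n → ℕ := fun i => i
    have ht : FirstOrder.Language.Structure.RelMap (L := tupleLanguage) (M := ℕ) t t :=
      ⟨1, G.one_mem, fun _ => rfl⟩
    obtain ⟨g, hg, hgt⟩ := (a.map_rel (n := n) t t).2 ht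
    exact ⟨g, hg, fun i hi => hgt ⟨i, hi⟩⟩
  · rintro ⟨L, S, hL, -, -, hG⟩
    convert isClosed_setOf_preserves L using 1
    ext g
    rw [SetLike.mem_coe, hG]
    constructor
    · rintro ⟨a, rfl⟩ n r x
      exact a.map_rel r x
    · intro h
      exact ⟨{ toEquiv := g
               map_fun' := fun f => isEmptyElim f
               map_rel' := fun r x => h _ r x }, rfl⟩
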